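/- arXiv:1703.06722 — 7 statements merged into one kernel-verified Lean document; each statement's English description precedes it below -/
import Mathlib

section
/- Let A and B be nonzero integers with A² + 4B > 0 such that the Lucas sequence of the second kind v corresponding to (A,B) is non-degenerate. Assume that (A,B) is not one of the pairs (1,1), (-1,1), (-1,2), (-2,1), (1,3), (-3,-1). Then there is no triple (k,l,m) of nonnegative integers with v_k < v_l < v_m and v_k + v_m = 2·v_l. -/
/-- Lucas sequence of the second kind for parameters `A`, `B`:
`v 0 = 2`, `v 1 = A`, `v (n+2) = A * v (n+1) + B * v n`. -/
def lucasV (A B : ℤ) : ℕ → ℤ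
  | 0 => 2
  | 1 => A
  | n + 2 => A * lucasV A B (n + 1) + B * lucasV A B n

/-- A sequence has only constant three-term arithmetic progressions. -/
def OnlyTrivialAP (v : ℕ → ℤ) : Prop :=
  ∀ i j l : ℕ, v i + v j = 2 * v l → v i = v l

/-- Once the terms grow strictly in absolute value from index `N` on, it suffices to exclude
progressions whose largest index is at an end, and those with all indices below `N`. -/
theorem onlyTrivialAP_of_abs_lt {v : ℕ → ℤ} (N : ℕ)
    (hdom : ∀ n, N ≤ n → ∀ l < n, |v l| < |v n|)
    (hmax : ∀ n, N ≤ n → ∀ j < n, ∀ l < n, v n + v j ≠ 2 * v l)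
    (hsmall : ∀ i < N, ∀ j < N, ∀ l < N, i ≠ j → i ≠ l → j ≠ l → v i + v j ≠ 2 * v l) :
    OnlyTrivialAP v := by
  intro i j l h
  by_cases hil : i = l
  · rw [hil]
  by_cases hjl : j = l
  · subst hjl; linarith
  by_cases hij : i = j
  · subst hij; linarith
  exfalso
  by_cases hs : i < N ∧ j < N ∧ l < N
  · exact hsmall i hs.1 j hs.2.1 l hs.2.2 hij hil hjl h
  rcases lt_trichotomy i j with hlt | heq | hlt
  · rcases lt_trichotomy j l with hlt' | heq' | hlt'
    · have h1 := hdom l (by omega) i (by omega)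
      have h2 := hdom l (by omega) j (by omega)
      have h3 := abs_add_le (v i) (v j)
      rw [h, abs_mul, abs_two] at h3
      linarith
    · exact hjl heq'
    · exact hmax j (by omega) i hlt l hlt' (by linarith)
  · exact hij heq
  · rcases lt_trichotomy i l with hlt' | heq' | hlt'
    · have h1 := hdom l (by omega) i (by omega)
      have h2 := hdom l (by omega) j (by omega)
      have h3 := abs_add_le (v i) (v j)
      rw [h, abs_mul, abs_two] at h3
      linarith
    · exact hil heq'
    · exact hmax i (by omega) j hlt l hlt' h

theorem onlyTrivialAP_of_two_mul_lt {w : ℕ → ℤ} (N : ℕ) (hpos : ∀ n, 0 < w n)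
    (hdouble : ∀ n, N ≤ n → ∀ l < n, 2 * w l < w n)
    (hsmall : ∀ i < N, ∀ j < N, ∀ l < N, i ≠ j → i ≠ l → j ≠ l → w i + w j ≠ 2 * w l) :
    OnlyTrivialAP w := by
  refine onlyTrivialAP_of_abs_lt N (fun n hn l hl => ?_) (fun n hn j hj l hl h => ?_) hsmall
  · rw [abs_of_pos (hpos l), abs_of_pos (hpos n)]
    linarith [hdouble n hn l hl, hpos l]
  · linarith [hdouble n hn l hl, hpos j]

theorem abs_neg_one_pow_mul (n : ℕ) {x : ℤ} (hx : 0 < x) : |(-1) ^ n * x| = x := by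
  rw [abs_mul, abs_pow, abs_neg, abs_one, one_pow, one_mul, abs_of_pos hx]

theorem onlyTrivialAP_alternating {w : ℕ → ℤ} (N : ℕ) (hpos : ∀ n, 0 < w n)
    (hle : ∀ n, N ≤ n + 2 → ∀ l ≤ n, w l ≤ w n)
    (hgrow : ∀ n, N ≤ n + 2 → 2 * w n + w (n + 1) < w (n + 2)) (hN : 2 ≤ N)
    (hsmall : ∀ i < N, ∀ j < N, ∀ l < N, i ≠ j → i ≠ l → j ≠ l →
      (-1) ^ i * w i + (-1) ^ j * w j ≠ 2 * ((-1) ^ l * w l)) :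
    OnlyTrivialAP fun n => (-1) ^ n * w n := by
  refine onlyTrivialAP_of_abs_lt N (fun n hn l hl => ?_) (fun n hn j hj l hl h => ?_) hsmall
  · obtain ⟨n, rfl⟩ : ∃ m, n = m + 2 := ⟨n - 2, by omega⟩
    rw [abs_neg_one_pow_mul _ (hpos _), abs_neg_one_pow_mul _ (hpos _)]
    linarith [hle (n + 1) (by omega) l (by omega), hgrow n hn, hpos n]
  · obtain ⟨n, rfl⟩ : ∃ m, n = m + 2 := ⟨n - 2, by omega⟩
    have hg := hgrow n hn
    have hj' := hle (n + 1) (by omega) j (by omega)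
    have hn0 := hpos n
    have hj0 := hpos j
    have hl0 := hpos l
    by_cases hp : l = n + 1
    · subst hp
      rcases neg_one_pow_eq_or ℤ n with e | e <;> rcases neg_one_pow_eq_or ℤ j with f | f <;>
        simp only [pow_succ, e, f] at h <;> linarith
    · have hl' := hle n hn l (by omega)
      rcases neg_one_pow_eq_or ℤ n with e | e <;> rcases neg_one_pow_eq_or ℤ j with f | f <;>
        rcases neg_one_pow_eq_or ℤ l with g | g <;>
        simp only [pow_succ, e, f, g] at h <;> linarith

theorem le_of_le_succ_from {w : ℕ → ℤ} (N : ℕ) (h0 : ∀ l ≤ N, w l ≤ w N)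
    (h : ∀ n, N ≤ n → w n ≤ w (n + 1)) : ∀ n, N ≤ n → ∀ l ≤ n, w l ≤ w n := by
  intro n hn
  induction n, hn using Nat.le_induction with
  | base => exact h0
  | succ n hn ih =>
    intro l hl
    rcases Nat.lt_or_ge n l with h' | h'
    · rw [show l = n + 1 by omega]
    · exact (ih l h').trans (h n hn)

theorem lucasV_zero (A B : ℤ) : lucasV A B 0 = 2 := rfl

theorem lucasV_one (A B : ℤ) : lucasV A B 1 = A := rfl

theorem lucasV_add_two (A B : ℤ) (n : ℕ) :
    lucasV A B (n + 2) = A * lucasV A B (n + 1) + B * lucasV A B n := rfl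

theorem lucasV_neg (A B : ℤ) (n : ℕ) : lucasV (-A) B n = (-1) ^ n * lucasV A B n := by
  induction n using Nat.twoStepInduction with
  | zero => simp [lucasV_zero]
  | one => simp [lucasV_one]
  | more n ih1 ih2 =>
    rw [lucasV_add_two, lucasV_add_two, ih1, ih2]
    ring

theorem lucasV_neg_eq (A B : ℤ) : lucasV (-A) B = fun n => (-1) ^ n * lucasV A B n :=
  funext (lucasV_neg A B)

theorem lucasV_pos_of_pos {a B : ℤ} (ha : 0 < a) (hB : 0 < B) (n : ℕ) : 0 < lucasV a B n := by
  induction n using Nat.twoStepInduction with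
  | zero => simp [lucasV_zero]
  | one => simpa [lucasV_one]
  | more n ih1 ih2 => rw [lucasV_add_two]; positivity

/-! ### The case of negative `B` -/

theorem lucasV_pos_and_mul_le {a B : ℤ} (ha : 0 < a) (hB : B < 0) (hD : 0 < a ^ 2 + 4 * B)
    (n : ℕ) : 0 < lucasV a B n ∧ a * lucasV a B n ≤ 2 * lucasV a B (n + 1) := by
  induction n with
  | zero => simp [lucasV_zero, lucasV_one, mul_comm]
  | succ n ih =>
    obtain ⟨h1, h2⟩ := ih
    have h3 : 0 < lucasV a B (n + 1) := by
      have := mul_pos ha h1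
      linarith
    refine ⟨h3, ?_⟩
    rw [lucasV_add_two]
    have h4 : a * (a * lucasV a B (n + 1)) ≤
        a * (2 * (a * lucasV a B (n + 1) + B * lucasV a B n)) := by
      nlinarith [mul_le_mul_of_nonneg_left h2 (neg_nonneg.2 hB.le), mul_pos hD h3]
    exact le_of_mul_le_mul_left h4 ha

theorem two_mul_lucasV_lt_of_neg {a B : ℤ} (ha : 0 < a) (hB : B < 0) (hD : 0 < a ^ 2 + 4 * B)
    (hne : ¬ (a = 3 ∧ B = -2)) (n : ℕ) : 2 * lucasV a B (n + 1) < lucasV a B (n + 2) := by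
  obtain ⟨h1, h2⟩ := lucasV_pos_and_mul_le ha hB hD n
  have h3 := (lucasV_pos_and_mul_le ha hB hD (n + 1)).1
  have ha3 : 3 ≤ a := by nlinarith
  rw [lucasV_add_two]
  rcases ha3.eq_or_lt with rfl | ha4
  · have : B = -1 := by omega
    subst this
    linarith
  · have h4 : a * (2 * lucasV a B (n + 1)) <
        a * (a * lucasV a B (n + 1) + B * lucasV a B n) := by
      nlinarith [mul_le_mul_of_nonneg_left h2 (neg_nonneg.2 hB.le), mul_pos hD h3,
        mul_nonneg (mul_nonneg ha.le (sub_nonneg.2 (Int.add_one_le_iff.2 ha4))) h3.le]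
    exact lt_of_mul_lt_mul_left h4 ha.le

/-! ### The generic case `2 ≤ |A|` -/

theorem lucasV_pos {a B : ℤ} (ha : 0 < a) (hB : B ≠ 0) (hD : 0 < a ^ 2 + 4 * B) (n : ℕ) :
    0 < lucasV a B n := by
  rcases hB.lt_or_gt with hB | hB
  · exact (lucasV_pos_and_mul_le ha hB hD n).1
  · exact lucasV_pos_of_pos ha hB n

theorem two_mul_lucasV_lt {a B : ℤ} (ha : 2 ≤ a) (hB : B ≠ 0) (hD : 0 < a ^ 2 + 4 * B)
    (hne : ¬ (a = 3 ∧ B = -2)) (n : ℕ) : 2 * lucasV a B (n + 1) < lucasV a B (n + 2) := by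
  rcases hB.lt_or_gt with hB | hB
  · exact two_mul_lucasV_lt_of_neg (by linarith) hB hD hne n
  · have h1 := lucasV_pos_of_pos (by linarith : 0 < a) hB n
    have h2 := lucasV_pos_of_pos (by linarith : 0 < a) hB (n + 1)
    rw [lucasV_add_two]
    nlinarith [mul_pos hB h1]

theorem lucasV_le_of_le {a B : ℤ} (ha : 2 ≤ a) (hB : B ≠ 0) (hD : 0 < a ^ 2 + 4 * B)
    (hne : ¬ (a = 3 ∧ B = -2)) (n l : ℕ) (hl : l ≤ n) : lucasV a B l ≤ lucasV a B n := by
  refine le_of_le_succ_from 0 (fun l hl => ?_) (fun n _ => ?_) n (Nat.zero_le n) l hl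
  · rw [Nat.le_zero.1 hl]
  · cases n with
    | zero => simpa [lucasV_zero, lucasV_one]
    | succ n =>
      linarith [two_mul_lucasV_lt ha hB hD hne n,
        lucasV_pos (by linarith : 0 < a) hB hD (n + 1)]

theorem onlyTrivialAP_lucasV {a B : ℤ} (ha : 2 ≤ a) (hB : B ≠ 0) (hD : 0 < a ^ 2 + 4 * B)
    (hne : ¬ (a = 3 ∧ B = -2)) : OnlyTrivialAP (lucasV a B) := by
  refine onlyTrivialAP_of_two_mul_lt 2 (lucasV_pos (by linarith) hB hD) (fun n hn l hl => ?_)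
    (fun i hi j hj l hl h1 h2 h3 => by omega)
  obtain ⟨n, rfl⟩ : ∃ m, n = m + 2 := ⟨n - 2, by omega⟩
  linarith [lucasV_le_of_le ha hB hD hne (n + 1) l (by omega), two_mul_lucasV_lt ha hB hD hne n]

theorem onlyTrivialAP_lucasV_neg {a B : ℤ} (ha : 2 ≤ a) (hB : B ≠ 0) (hD : 0 < a ^ 2 + 4 * B)
    (hne : ¬ (a = 3 ∧ B = -2)) (hne2 : ¬ (a = 2 ∧ B = 1)) (hne3 : ¬ (a = 3 ∧ B = -1)) :
    OnlyTrivialAP (lucasV (-a) B) := by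
  rw [lucasV_neg_eq]
  refine onlyTrivialAP_alternating 3 (lucasV_pos (by linarith) hB hD)
    (fun n _ l hl => lucasV_le_of_le ha hB hD hne n l hl) (fun n hn => ?_) (by norm_num) ?_
  · obtain ⟨n, rfl⟩ : ∃ m, n = m + 1 := ⟨n - 1, by omega⟩
    linarith [two_mul_lucasV_lt ha hB hD hne n, two_mul_lucasV_lt ha hB hD hne (n + 1)]
  · have hlt := two_mul_lucasV_lt ha hB hD hne 0
    have h4 : lucasV a B 2 ≠ 4 + a := by
      rw [lucasV_add_two, zero_add, lucasV_one, lucasV_zero]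
      intro h
      have ha4 : a < 4 := by nlinarith
      interval_cases a <;> omega
    rw [zero_add, zero_add, lucasV_one] at hlt
    intro i hi j hj l hl h1 h2 h3
    interval_cases i <;> interval_cases j <;> interval_cases l <;>
      first
      | omega
      | (simp only [lucasV_zero, lucasV_one, pow_zero, pow_one, one_mul, even_two,
          Even.neg_pow, one_pow]; omega)

/-! ### The pairs `(±3, -2)`, where the terms are `(±1) ^ n * (2 ^ n + 1)` -/

theorem lucasV_three_neg_two (n : ℕ) : lucasV 3 (-2) n = 2 ^ n + 1 := by
  induction n using Nat.twoStepInduction with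
  | zero => simp [lucasV_zero]
  | one => simp [lucasV_one]
  | more n ih1 ih2 =>
    rw [lucasV_add_two, ih1, ih2]
    ring

theorem two_pow_le_two_pow {m n : ℕ} (h : m ≤ n) : (2 : ℤ) ^ m ≤ 2 ^ n :=
  pow_le_pow_right₀ (by norm_num) h

theorem onlyTrivialAP_lucasV_three_neg_two : OnlyTrivialAP (lucasV 3 (-2)) := by
  have key : ∀ n, 1 ≤ n → ∀ l < n, (2 : ℤ) * 2 ^ l ≤ 2 ^ n := fun n _ l hl => by
    have := two_pow_le_two_pow (show l + 1 ≤ n by omega)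
    rw [pow_succ] at this
    linarith
  have hpos : ∀ n : ℕ, (0 : ℤ) < 2 ^ n := fun n => by positivity
  refine onlyTrivialAP_of_abs_lt 1 (fun n hn l hl => ?_) (fun n hn j hj l hl h => ?_)
    (fun i hi j hj l hl h1 h2 h3 => by omega)
  · rw [lucasV_three_neg_two, lucasV_three_neg_two, abs_of_pos (by positivity),
      abs_of_pos (by positivity)]
    linarith [key n hn l hl, hpos l]
  · simp only [lucasV_three_neg_two] at h
    linarith [key n hn l hl, hpos j]

theorem onlyTrivialAP_lucasV_neg_three_neg_two : OnlyTrivialAP (lucasV (-3) (-2)) := by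
  have hpos : ∀ n : ℕ, (0 : ℤ) < 2 ^ n := fun n => by positivity
  rw [lucasV_neg_eq]
  simp only [lucasV_three_neg_two]
  refine onlyTrivialAP_of_abs_lt 4 (fun n hn l hl => ?_) (fun n hn j hj l hl h => ?_) ?_
  · rw [abs_neg_one_pow_mul _ (by positivity), abs_neg_one_pow_mul _ (by positivity)]
    linarith [pow_lt_pow_right₀ (by norm_num : (1 : ℤ) < 2) hl]
  · obtain ⟨n, rfl⟩ : ∃ m, n = m + 4 := ⟨n - 4, by omega⟩
    have hp : (1 : ℤ) ≤ 2 ^ n := hpos n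
    have hj0 := hpos j
    have hl0 := hpos l
    have hj3 := two_pow_le_two_pow (show j ≤ n + 3 by omega)
    have hj1 : j = n + 3 ∨ j = n + 2 ∨ (2 : ℤ) ^ j ≤ 2 ^ (n + 1) := by
      by_cases hj1 : j ≤ n + 1
      · exact Or.inr (Or.inr (two_pow_le_two_pow hj1))
      · omega
    have hl1 : l = n + 3 ∨ l = n + 2 ∨ (2 : ℤ) ^ l ≤ 2 ^ (n + 1) := by
      by_cases hl1 : l ≤ n + 1
      · exact Or.inr (Or.inr (two_pow_le_two_pow hl1))
      · omega
    have f := neg_one_pow_eq_or ℤ j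
    have g := neg_one_pow_eq_or ℤ l
    rcases hj1 with rfl | rfl | hj1 <;> rcases hl1 with rfl | rfl | hl1 <;>
      rcases neg_one_pow_eq_or ℤ n with e | e <;> rcases f with f | f <;> rcases g with g | g <;>
      simp only [pow_succ, e, f, g] at * <;> linarith
  · intro i hi j hj l hl h1 h2 h3
    interval_cases i <;> interval_cases j <;> interval_cases l <;> norm_num at *

/-! ### The case `|A| = 1` -/

theorem lucasV_one_two_eq (B : ℤ) : lucasV 1 B 2 = 1 + 2 * B := by
  rw [lucasV_add_two, zero_add, lucasV_one, lucasV_zero]; ring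

theorem lucasV_one_three_eq (B : ℤ) : lucasV 1 B 3 = 1 + 3 * B := by
  rw [lucasV_add_two, lucasV_one_two_eq, lucasV_one]; ring

theorem lucasV_one_le {B : ℤ} (hB : 0 < B) :
    ∀ n, 2 ≤ n → ∀ l ≤ n, lucasV 1 B l ≤ lucasV 1 B n := by
  refine le_of_le_succ_from 2 (fun l hl => ?_) (fun n hn => ?_)
  · interval_cases l <;> simp only [lucasV_zero, lucasV_one, lucasV_one_two_eq] <;> omega
  · obtain ⟨n, rfl⟩ : ∃ m, n = m + 2 := ⟨n - 2, by omega⟩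
    rw [lucasV_add_two _ _ (n + 1)]
    linarith [mul_pos hB (lucasV_pos_of_pos one_pos hB (n + 1))]

theorem onlyTrivialAP_lucasV_neg_one {B : ℤ} (hB : 3 ≤ B) : OnlyTrivialAP (lucasV (-1) B) := by
  have hpos := lucasV_pos_of_pos one_pos (by linarith : 0 < B)
  rw [lucasV_neg_eq]
  refine onlyTrivialAP_alternating 4 hpos
    (fun n hn l hl => lucasV_one_le (by linarith) n (by omega) l hl) (fun n _ => ?_)
    (by norm_num) ?_
  · rw [lucasV_add_two]
    nlinarith [hpos n]
  · intro i hi j hj l hl h1 h2 h3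
    interval_cases i <;> interval_cases j <;> interval_cases l <;>
      first
      | omega
      | (simp only [lucasV_zero, lucasV_one, lucasV_one_two_eq, lucasV_one_three_eq]; omega)

theorem lucasV_one_ratio {B : ℤ} (hB : 4 ≤ B) (n : ℕ) (hn : 3 ≤ n) :
    2 * lucasV 1 B n < lucasV 1 B (n + 1) ∧ lucasV 1 B (n + 1) < B * lucasV 1 B n := by
  induction n, hn using Nat.le_induction with
  | base =>
    rw [lucasV_add_two _ _ 2, lucasV_one_three_eq, lucasV_one_two_eq]
    constructor <;> nlinarith
  | succ n hn ih =>
    obtain ⟨h1, h2⟩ := ih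
    have hpos := lucasV_pos_of_pos one_pos (by linarith : 0 < B) (n + 1)
    rw [lucasV_add_two]
    constructor <;> nlinarith

theorem onlyTrivialAP_lucasV_one {B : ℤ} (hB : 4 ≤ B) : OnlyTrivialAP (lucasV 1 B) := by
  refine onlyTrivialAP_of_two_mul_lt 4 (lucasV_pos_of_pos one_pos (by linarith))
    (fun n hn l hl => ?_) ?_
  · obtain ⟨n, rfl⟩ : ∃ m, n = m + 1 := ⟨n - 1, by omega⟩
    linarith [lucasV_one_le (by linarith : 0 < B) n (by omega) l (by omega),
      (lucasV_one_ratio hB n (by omega)).1]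
  · intro i hi j hj l hl h1 h2 h3
    interval_cases i <;> interval_cases j <;> interval_cases l <;>
      first
      | omega
      | (simp only [lucasV_zero, lucasV_one, lucasV_one_two_eq, lucasV_one_three_eq]; omega)

theorem lucasV_one_two (n : ℕ) : lucasV 1 2 n = 2 ^ n + (-1) ^ n := by
  induction n using Nat.twoStepInduction with
  | zero => simp [lucasV_zero]
  | one => simp [lucasV_one]
  | more n ih1 ih2 =>
    rw [lucasV_add_two, ih1, ih2]
    ring

theorem lucasV_one_two_ne_three (n : ℕ) : lucasV 1 2 n ≠ 3 := by
  have h : ¬ (3 : ℤ) ∣ lucasV 1 2 n ∧ (3 : ℤ) ∣ lucasV 1 2 n + lucasV 1 2 (n + 1) := by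
    induction n with
    | zero => simp [lucasV_zero, lucasV_one]
    | succ n ih => rw [lucasV_add_two]; omega
  intro h3
  rw [h3] at h
  exact h.1 dvd_rfl

theorem onlyTrivialAP_lucasV_one_two : OnlyTrivialAP (lucasV 1 2) := by
  have hpos := lucasV_pos_of_pos one_pos (two_pos (α := ℤ))
  have hle : ∀ n l : ℕ, l ≤ n → lucasV 1 2 l ≤ 2 ^ n + 1 := fun n l hl => by
    rw [lucasV_one_two]
    rcases neg_one_pow_eq_or ℤ l with e | e <;> rw [e] <;> linarith [two_pow_le_two_pow hl]
  refine onlyTrivialAP_of_abs_lt 3 (fun n hn l hl => ?_) (fun n hn j hj l hl h => ?_) ?_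
  · obtain ⟨n, rfl⟩ : ∃ m, n = m + 3 := ⟨n - 3, by omega⟩
    rw [abs_of_pos (hpos _), abs_of_pos (hpos _), lucasV_one_two (n + 3)]
    have h1 := hle (n + 2) l (by omega)
    have h2 : (1 : ℤ) ≤ 2 ^ n := one_le_pow₀ (by norm_num)
    rcases neg_one_pow_eq_or ℤ n with e | e <;> simp only [pow_succ, e] at * <;> linarith
  · obtain ⟨n, rfl⟩ : ∃ m, n = m + 3 := ⟨n - 3, by omega⟩
    have h2 : (1 : ℤ) ≤ 2 ^ n := one_le_pow₀ (by norm_num)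
    have hj0 := hpos j
    have hj3 := lucasV_one_two_ne_three j
    rw [lucasV_one_two (n + 3)] at h
    by_cases hl2 : l = n + 2
    · rw [hl2, lucasV_one_two (n + 2)] at h
      rcases neg_one_pow_eq_or ℤ n with e | e <;> simp only [pow_succ, e] at h <;> omega
    · have h1 := hle (n + 1) l (by omega)
      rcases neg_one_pow_eq_or ℤ n with e | e <;> simp only [pow_succ, e] at * <;> linarith
  · intro i hi j hj l hl h1 h2 h3
    interval_cases i <;> interval_cases j <;> interval_cases l <;>
      first
      | omega
      | (simp only [lucasV_zero, lucasV_one, lucasV_one_two_eq]; omega)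

theorem stmt_5 (A B : ℤ) (hA : A ≠ 0) (hB : B ≠ 0) (hdom : A ^ 2 + 4 * B > 0)
    (hnd : ∀ α β : ℂ, α + β = (A : ℂ) → α * β = -(B : ℂ) →
      ∀ n : ℕ, 0 < n → (α / β) ^ n ≠ 1)
    (h1 : (A, B) ≠ (1, 1)) (h2 : (A, B) ≠ (-1, 1)) (h3 : (A, B) ≠ (-1, 2))
    (h4 : (A, B) ≠ (-2, 1)) (h5 : (A, B) ≠ (1, 3)) (h6 : (A, B) ≠ (-3, -1)) :
    ¬ ∃ k l m : ℕ, lucasV A B k < lucasV A B l ∧ lucasV A B l < lucasV A B m ∧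
      lucasV A B k + lucasV A B m = 2 * lucasV A B l := by
  suffices h : OnlyTrivialAP (lucasV A B) by
    rintro ⟨k, l, m, hkl, -, he⟩
    exact hkl.ne (h k m l he)
  simp only [ne_eq, Prod.mk.injEq] at h1 h2 h3 h4 h5 h6
  rcases hA.lt_or_gt with hA' | hA'
  · obtain ⟨a, rfl⟩ : ∃ a, A = -a := ⟨-A, by ring⟩
    rw [neg_sq] at hdom
    rcases (show 1 ≤ a by omega).eq_or_lt with rfl | ha
    · exact onlyTrivialAP_lucasV_neg_one (by omega)
    · by_cases hne : a = 3 ∧ B = -2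
      · obtain ⟨rfl, rfl⟩ := hne
        exact onlyTrivialAP_lucasV_neg_three_neg_two
      · exact onlyTrivialAP_lucasV_neg ha hB hdom hne (by omega) (by omega)
  · rcases (show 1 ≤ A by omega).eq_or_lt with rfl | ha
    · rcases (show B = 2 ∨ 4 ≤ B by omega) with rfl | hB4
      · exact onlyTrivialAP_lucasV_one_two
      · exact onlyTrivialAP_lucasV_one hB4
    · by_cases hne : A = 3 ∧ B = -2
      · obtain ⟨rfl, rfl⟩ := hne
        exact onlyTrivialAP_lucasV_three_neg_two
      · exact onlyTrivialAP_lucasV ha hB hdom hne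
end

section
/- Let u be the Lucas sequence of the first kind corresponding to (A,B) = (-1,2). Then a triple (k,l,m) of nonnegative integers satisfies u_m − u_l = u_l − u_k ≠ 0 (i.e., (u_k, u_l, u_m) is a non-constant arithmetic progression in this order) if and only if (k,l,m) or its reversal (m,l,k) belongs to the set {(t+2, t, t+1) : t ≥ 0}. -/
/-- Lucas sequence of the first kind for parameters `A`, `B`:
`u 0 = 0`, `u 1 = 1`, `u (n+2) = A * u (n+1) + B * u n`. -/
def lucasU (A B : ℤ) : ℕ → ℤ
  | 0 => 0
  | 1 => 1
  | n + 2 => A * lucasU A B (n + 1) + B * lucasU A B n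

theorem three_mul_lucasU_neg_one_two (n : ℕ) : 3 * lucasU (-1) 2 n = 1 - (-2) ^ n := by
  induction n using Nat.twoStepInduction with
  | zero => simp [lucasU]
  | one => simp [lucasU]
  | more n ih₀ ih₁ =>
    rw [lucasU]
    linear_combination 2 * ih₀ - ih₁

theorem neg_two_pow_injective : Function.Injective fun n : ℕ => (-2 : ℤ) ^ n := by
  intro a b h
  have h' := congrArg Int.natAbs h
  simp only [Int.natAbs_pow] at h'
  exact Nat.pow_right_injective le_rfl h'

theorem eq_of_neg_two_pow_add_eq {k l d : ℕ}
    (h : (-2 : ℤ) ^ k + (-2) ^ (k + (d + 1)) = 2 * (-2) ^ l) : d = 0 ∧ k = l + 1 := by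
  have pow_ne (n : ℕ) : (-2 : ℤ) ^ n ≠ 0 := pow_ne_zero n (by norm_num)
  rcases lt_trichotomy k (l + 1) with hk | rfl | hk
  · obtain ⟨e, rfl⟩ := Nat.exists_eq_add_of_le (Nat.lt_succ_iff.mp hk)
    have h' : 1 + (-2 : ℤ) ^ d * (-2) = 2 * (-2) ^ e :=
      mul_left_cancel₀ (pow_ne k) (by linear_combination h)
    omega
  · have h' : (-2 : ℤ) ^ d = 1 :=
      mul_left_cancel₀ (mul_ne_zero four_ne_zero (pow_ne l)) (by linear_combination h)
    exact ⟨neg_two_pow_injective (by simpa using h'), rfl⟩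
  · obtain ⟨e, rfl⟩ := Nat.exists_eq_add_of_le (show l + 2 ≤ k from hk)
    have h' : 4 * ((-2 : ℤ) ^ e * (1 + (-2) ^ (d + 1))) = 2 :=
      mul_left_cancel₀ (pow_ne l) (by linear_combination h)
    omega

theorem stmt_7 (k l m : ℕ) :
    (lucasU (-1) 2 m - lucasU (-1) 2 l = lucasU (-1) 2 l - lucasU (-1) 2 k ∧
        lucasU (-1) 2 l - lucasU (-1) 2 k ≠ 0) ↔
      ((∃ t : ℕ, (k, l, m) = (t + 2, t, t + 1)) ∨
        (∃ t : ℕ, (m, l, k) = (t + 2, t, t + 1))) := by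
  have hk := three_mul_lucasU_neg_one_two k
  have hl := three_mul_lucasU_neg_one_two l
  have hm := three_mul_lucasU_neg_one_two m
  simp only [Prod.mk.injEq]
  constructor
  · rintro ⟨h, hne⟩
    have hsum : (-2 : ℤ) ^ k + (-2) ^ m = 2 * (-2) ^ l := by linarith
    rcases lt_trichotomy k m with hkm | rfl | hkm
    · obtain ⟨d, rfl⟩ := Nat.exists_eq_add_of_lt hkm
      obtain ⟨rfl, rfl⟩ := eq_of_neg_two_pow_add_eq hsum
      exact Or.inr ⟨l, rfl, rfl, rfl⟩
    · exact absurd (by linarith) hne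
    · obtain ⟨d, rfl⟩ := Nat.exists_eq_add_of_lt hkm
      obtain ⟨rfl, rfl⟩ := eq_of_neg_two_pow_add_eq (by rwa [add_comm] at hsum)
      exact Or.inl ⟨l, rfl, rfl, rfl⟩
  · rintro (⟨t, rfl, rfl, rfl⟩ | ⟨t, rfl, rfl, rfl⟩)
    all_goals
      have hne : (-2 : ℤ) ^ l ≠ 0 := pow_ne_zero l (by norm_num)
      simp only [pow_succ] at hk hm
      omega
end

section
/- Let u be the Lucas sequence of the first kind corresponding to (A,B) = (1,2) (the Jacobsthal sequence). Then a triple (k,l,m) of nonnegative integers satisfies u_m − u_l = u_l − u_k ≠ 0 (i.e., (u_k, u_l, u_m) is a non-constant arithmetic progression in this order) if and only if (k,l,m) or its reversal (m,l,k) belongs to the set {(1, 2t+1, 2t+2) : t ≥ 1} ∪ {(2, 2t+1, 2t+2) : t ≥ 1}. -/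
/-- The exceptional triples for `(A, B) = (1, 2)` (the Jacobsthal sequence). -/
def jacobsthalAPSet : Set (ℕ × ℕ × ℕ) :=
  {p | ∃ t : ℕ, 1 ≤ t ∧ p = (1, 2 * t + 1, 2 * t + 2)} ∪
    {p | ∃ t : ℕ, 1 ≤ t ∧ p = (2, 2 * t + 1, 2 * t + 2)}

theorem lucasU_one_two_add_two (n : ℕ) :
    lucasU 1 2 (n + 2) = lucasU 1 2 (n + 1) + 2 * lucasU 1 2 n := by
  rw [lucasU, one_mul]

theorem lucasU_one_two_succ (n : ℕ) : lucasU 1 2 (n + 1) = 2 * lucasU 1 2 n + (-1) ^ n := by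
  induction n with
  | zero => simp [lucasU]
  | succ n ih => rw [lucasU_one_two_add_two, pow_succ]; linarith

theorem lucasU_one_two_nonneg_and_succ_pos (n : ℕ) :
    0 ≤ lucasU 1 2 n ∧ 0 < lucasU 1 2 (n + 1) := by
  induction n with
  | zero => simp [lucasU]
  | succ n ih => rw [lucasU_one_two_add_two]; constructor <;> linarith [ih.1, ih.2]

theorem lucasU_one_two_monotone : Monotone (lucasU 1 2) := by
  refine monotone_nat_of_le_succ fun n => ?_
  cases n with
  | zero => simp [lucasU]
  | succ n =>
    rw [lucasU_one_two_add_two]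
    linarith [(lucasU_one_two_nonneg_and_succ_pos n).1]

theorem lucasU_one_two_eq_one {n : ℕ} (h : lucasU 1 2 n = 1) : n = 1 ∨ n = 2 := by
  have h3 : n < 3 := by
    by_contra! hn
    have := lucasU_one_two_monotone hn
    norm_num [lucasU] at this
    lia
  interval_cases n
  · simp [lucasU] at h
  · simp
  · simp

theorem mem_jacobsthalAPSet_of_lt {k l m : ℕ}
    (h : lucasU 1 2 m - lucasU 1 2 l = lucasU 1 2 l - lucasU 1 2 k)
    (hlt : lucasU 1 2 k < lucasU 1 2 l) : (k, l, m) ∈ jacobsthalAPSet := by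
  have hk := (lucasU_one_two_nonneg_and_succ_pos k).1
  have hlm : l < m := lucasU_one_two_monotone.reflect_lt (by linarith)
  have hml : m < l + 2 := by
    refine lucasU_one_two_monotone.reflect_lt ?_
    rw [lucasU_one_two_add_two]
    linarith [(lucasU_one_two_nonneg_and_succ_pos l).2]
  obtain rfl : m = l + 1 := by lia
  rw [lucasU_one_two_succ] at h
  obtain hl | ⟨t, rfl⟩ := Nat.even_or_odd l
  · rw [hl.neg_one_pow] at h
    linarith
  · rw [(odd_two_mul_add_one t).neg_one_pow] at h
    have hk1 : lucasU 1 2 k = 1 := by linarith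
    have ht : 1 ≤ t := by
      by_contra! ht
      obtain rfl : t = 0 := by lia
      simp [lucasU, hk1] at hlt
    obtain rfl | rfl := lucasU_one_two_eq_one hk1
    · exact Or.inl ⟨t, ht, rfl⟩
    · exact Or.inr ⟨t, ht, rfl⟩

theorem progression_of_mem_jacobsthalAPSet {k l m : ℕ} (h : (k, l, m) ∈ jacobsthalAPSet) :
    lucasU 1 2 m - lucasU 1 2 l = lucasU 1 2 l - lucasU 1 2 k ∧
      lucasU 1 2 k < lucasU 1 2 l := by
  obtain ⟨hk, t, ht, rfl, rfl⟩ :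
      lucasU 1 2 k = 1 ∧ ∃ t, 1 ≤ t ∧ l = 2 * t + 1 ∧ m = 2 * t + 2 := by
    rcases h with ⟨t, ht, h⟩ | ⟨t, ht, h⟩ <;>
    · simp only [Prod.mk.injEq] at h
      obtain ⟨rfl, rfl, rfl⟩ := h
      exact ⟨by simp [lucasU], t, ht, rfl, rfl⟩
  have h3 : lucasU 1 2 3 ≤ lucasU 1 2 (2 * t + 1) := lucasU_one_two_monotone (by lia)
  norm_num [lucasU] at h3
  rw [lucasU_one_two_succ (2 * t + 1), (odd_two_mul_add_one t).neg_one_pow, hk]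
  constructor <;> linarith

theorem stmt_8 (k l m : ℕ) :
    (lucasU 1 2 m - lucasU 1 2 l = lucasU 1 2 l - lucasU 1 2 k ∧
        lucasU 1 2 l - lucasU 1 2 k ≠ 0) ↔
      ((k, l, m) ∈ jacobsthalAPSet ∨ (m, l, k) ∈ jacobsthalAPSet) := by
  constructor
  · rintro ⟨h, hne⟩
    obtain hlt | hlt := (sub_ne_zero.mp hne).lt_or_gt
    · exact Or.inr (mem_jacobsthalAPSet_of_lt (by linarith) (by linarith))
    · exact Or.inl (mem_jacobsthalAPSet_of_lt h hlt)
  · rintro (h | h)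
    · obtain ⟨h, hlt⟩ := progression_of_mem_jacobsthalAPSet h
      exact ⟨h, sub_ne_zero.mpr hlt.ne'⟩
    · obtain ⟨h, hlt⟩ := progression_of_mem_jacobsthalAPSet h
      exact ⟨by linarith, fun h0 => by linarith⟩
end

section
/- Let v be the Lucas sequence of the second kind corresponding to (A,B) = (1,1) (the sequence of Lucas numbers). Then a triple (k,l,m) of nonnegative integers satisfies v_m − v_l = v_l − v_k ≠ 0 (i.e., (v_k, v_l, v_m) is a non-constant arithmetic progression in this order) if and only if (k,l,m) or its reversal (m,l,k) belongs to the set {(1,0,2)} ∪ {(t, t+2, t+3) : t ≥ 0}. -/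
/-- The exceptional triples for `(A, B) = (1, 1)` (the Lucas numbers). -/
def lucasNumbersAPSet : Set (ℕ × ℕ × ℕ) :=
  {(1, 0, 2)} ∪ {p | ∃ t : ℕ, p = (t, t + 2, t + 3)}

theorem lucasV_one_one_add_two (n : ℕ) :
    lucasV 1 1 (n + 2) = lucasV 1 1 (n + 1) + lucasV 1 1 n := by
  simp [lucasV]

theorem lucasV_one_one_pos (n : ℕ) : 0 < lucasV 1 1 n := by
  induction n using Nat.twoStepInduction with
  | zero => simp [lucasV]
  | one => simp [lucasV]
  | more n h₀ h₁ => rw [lucasV_one_one_add_two]; omega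

theorem strictMono_lucasV_one_one_succ : StrictMono fun n ↦ lucasV 1 1 (n + 1) :=
  strictMono_nat_of_lt_succ fun n ↦ by
    rw [lucasV_one_one_add_two]
    exact lt_add_of_pos_right _ (lucasV_one_one_pos n)

theorem three_le_lucasV_one_one (n : ℕ) : 3 ≤ lucasV 1 1 (n + 2) := by
  simpa [lucasV] using
    strictMono_lucasV_one_one_succ.monotone (show 1 ≤ n + 1 by omega)

theorem injective_lucasV_one_one : Function.Injective (lucasV 1 1) := by
  have two_ne (n : ℕ) : lucasV 1 1 (n + 1) ≠ 2 := by
    rcases n with _ | n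
    · simp [lucasV]
    · exact ne_of_gt (lt_of_lt_of_le (by norm_num) (three_le_lucasV_one_one n))
  rintro (_ | a) (_ | b) h
  · rfl
  · exact absurd h.symm (two_ne b)
  · exact absurd h (two_ne a)
  · exact congrArg _ (strictMono_lucasV_one_one_succ.injective h)

/-- The increasing three-term progressions of Lucas numbers are exceptional triples. -/
theorem mem_lucasNumbersAPSet_of_lt {k l m : ℕ}
    (h : lucasV 1 1 m - lucasV 1 1 l = lucasV 1 1 l - lucasV 1 1 k)
    (hlt : lucasV 1 1 k < lucasV 1 1 l) : (k, l, m) ∈ lucasNumbersAPSet := by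
  have hk := lucasV_one_one_pos k
  have h0 : lucasV 1 1 0 = 2 := by simp [lucasV]
  have h1 : lucasV 1 1 1 = 1 := by simp [lucasV]
  have h2 : lucasV 1 1 2 = 3 := by simp [lucasV]
  rcases l with _ | _ | j
  · have hk1 : k = 1 := injective_lucasV_one_one (by omega)
    subst hk1
    have hm2 : m = 2 := injective_lucasV_one_one (by omega)
    subst hm2
    exact Or.inl rfl
  · rw [zero_add] at hlt
    omega
  · have hj := three_le_lucasV_one_one j
    have e₂ := lucasV_one_one_add_two j
    have e₃ : lucasV 1 1 (j + 3) = lucasV 1 1 (j + 2) + lucasV 1 1 (j + 1) :=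
      lucasV_one_one_add_two (j + 1)
    have e₄ : lucasV 1 1 (j + 4) = lucasV 1 1 (j + 3) + lucasV 1 1 (j + 2) :=
      lucasV_one_one_add_two (j + 2)
    have hpos := lucasV_one_one_pos (j + 1)
    rw [show j + 1 + 1 = j + 2 from rfl] at h hlt ⊢
    rcases m with _ | n
    · omega
    · have hlow : j + 1 < n := strictMono_lucasV_one_one_succ.lt_iff_lt.mp
        (show lucasV 1 1 (j + 2) < lucasV 1 1 (n + 1) by omega)
      have hupp : n < j + 3 := strictMono_lucasV_one_one_succ.lt_iff_lt.mp
        (show lucasV 1 1 (n + 1) < lucasV 1 1 (j + 4) by omega)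
      obtain rfl : n = j + 2 := by omega
      rw [show j + 2 + 1 = j + 3 from rfl] at h ⊢
      obtain rfl : k = j := injective_lucasV_one_one (by omega)
      exact Or.inr ⟨k, rfl⟩

theorem isAP_of_mem_lucasNumbersAPSet {k l m : ℕ} (h : (k, l, m) ∈ lucasNumbersAPSet) :
    lucasV 1 1 m - lucasV 1 1 l = lucasV 1 1 l - lucasV 1 1 k ∧
      lucasV 1 1 l - lucasV 1 1 k ≠ 0 := by
  rcases h with h | ⟨t, h⟩
  · obtain ⟨rfl, rfl, rfl⟩ : k = 1 ∧ l = 0 ∧ m = 2 := by simpa using h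
    simp [lucasV]
  · obtain ⟨rfl, rfl, rfl⟩ : k = t ∧ l = t + 2 ∧ m = t + 3 := by simpa using h
    have e₂ := lucasV_one_one_add_two k
    have e₃ : lucasV 1 1 (k + 3) = lucasV 1 1 (k + 2) + lucasV 1 1 (k + 1) :=
      lucasV_one_one_add_two (k + 1)
    have hpos := lucasV_one_one_pos (k + 1)
    omega

theorem stmt_9 (k l m : ℕ) :
    (lucasV 1 1 m - lucasV 1 1 l = lucasV 1 1 l - lucasV 1 1 k ∧
        lucasV 1 1 l - lucasV 1 1 k ≠ 0) ↔
      ((k, l, m) ∈ lucasNumbersAPSet ∨ (m, l, k) ∈ lucasNumbersAPSet) := by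
  constructor
  · rintro ⟨h, hne⟩
    rcases lt_or_gt_of_ne (sub_ne_zero.mp hne) with hlt | hlt
    · exact Or.inr (mem_lucasNumbersAPSet_of_lt (by omega) (by omega))
    · exact Or.inl (mem_lucasNumbersAPSet_of_lt h hlt)
  · rintro (h | h)
    · exact isAP_of_mem_lucasNumbersAPSet h
    · have := isAP_of_mem_lucasNumbersAPSet h
      omega
end

section
/- Let A and B be nonzero integers with A² + 4B > 0 such that the Lucas sequence of the first kind u corresponding to (A,B) is non-degenerate. If the set of triples (k,l,m) of nonnegative integers with u_k < u_l < u_m and u_k + u_m = 2·u_l contains more than two elements, then this set is infinite. -/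
@[simp] theorem lucasU_zero (A B : ℤ) : lucasU A B 0 = 0 := rfl

@[simp] theorem lucasU_one (A B : ℤ) : lucasU A B 1 = 1 := rfl

theorem lucasU_add_two (A B : ℤ) (n : ℕ) :
    lucasU A B (n + 2) = A * lucasU A B (n + 1) + B * lucasU A B n := rfl

theorem lucasU_neg (A B : ℤ) (n : ℕ) :
    lucasU (-A) B n = (-1) ^ (n + 1) * lucasU A B n := by
  induction n using Nat.twoStepInduction with
  | zero => simp
  | one => simp
  | more n ih₀ ih₁ =>
    rw [lucasU_add_two, lucasU_add_two, ih₀, ih₁]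
    ring

/-- The triples of indices of three-term arithmetic progressions in `lucasU A B`. -/
def lucasAP (A B : ℤ) : Set (ℕ × ℕ × ℕ) :=
  {p | lucasU A B p.1 < lucasU A B p.2.1 ∧ lucasU A B p.2.1 < lucasU A B p.2.2 ∧
    lucasU A B p.1 + lucasU A B p.2.2 = 2 * lucasU A B p.2.1}

section Growth

variable {a B : ℤ}

theorem lucasU_growth (ha : 0 < a) (hD : 0 < a ^ 2 + 4 * B) (n : ℕ) :
    0 ≤ lucasU a B n ∧ a * lucasU a B n < 2 * lucasU a B (n + 1) := by
  induction n with
  | zero => simp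
  | succ n ih =>
    obtain ⟨h₀, h₁⟩ := ih
    have hpos : 0 < lucasU a B (n + 1) := by nlinarith
    refine ⟨hpos.le, ?_⟩
    rw [lucasU_add_two]
    have h₂ : a * (a * lucasU a B n) < a * (2 * lucasU a B (n + 1)) :=
      mul_lt_mul_of_pos_left h₁ ha
    nlinarith [mul_nonneg hD.le h₀]

theorem lucasU_nonneg (ha : 0 < a) (hD : 0 < a ^ 2 + 4 * B) (n : ℕ) : 0 ≤ lucasU a B n :=
  (lucasU_growth ha hD n).1

theorem lucasU_succ_pos (ha : 0 < a) (hD : 0 < a ^ 2 + 4 * B) (n : ℕ) :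
    0 < lucasU a B (n + 1) := by
  obtain ⟨h₀, h₁⟩ := lucasU_growth ha hD n
  nlinarith

theorem two_mul_lucasU_lt_succ_of_three_le (ha : 3 ≤ a) (hD : 0 < a ^ 2 + 4 * B) (n : ℕ) :
    2 * lucasU a B n < lucasU a B (n + 1) := by
  rcases ha.eq_or_lt with rfl | h4
  · have hB : -2 ≤ B := by omega
    induction n with
    | zero => simp
    | succ n ih =>
      rw [lucasU_add_two]
      nlinarith [lucasU_nonneg (by norm_num) hD n]
  · obtain ⟨h₀, h₁⟩ := lucasU_growth (by omega) hD n
    nlinarith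

theorem two_mul_lucasU_lt_succ (ha : 2 ≤ a) (hB : B ≠ 0) (hD : 0 < a ^ 2 + 4 * B) {n : ℕ}
    (hn : n ≠ 1) : 2 * lucasU a B n < lucasU a B (n + 1) := by
  rcases ha.eq_or_lt with rfl | h3
  · have hB : 1 ≤ B := by omega
    match n with
    | 0 => simp
    | 1 => exact absurd rfl hn
    | n + 2 =>
      rw [lucasU_add_two _ _ (n + 1)]
      nlinarith [lucasU_succ_pos (by norm_num) hD n]
  · exact two_mul_lucasU_lt_succ_of_three_le (by omega) hD n

theorem two_mul_lucasU_le_succ (ha : 2 ≤ a) (hB : B ≠ 0) (hD : 0 < a ^ 2 + 4 * B) (n : ℕ) :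
    2 * lucasU a B n ≤ lucasU a B (n + 1) := by
  by_cases hn : n = 1
  · subst hn
    simpa [lucasU_add_two] using ha
  · exact (two_mul_lucasU_lt_succ ha hB hD hn).le

theorem lucasU_monotone (ha : 0 < a) (hB : B ≠ 0) (hD : 0 < a ^ 2 + 4 * B) :
    Monotone (lucasU a B) := by
  refine monotone_nat_of_le_succ fun n => ?_
  rcases (show 1 ≤ a by omega).eq_or_lt with rfl | h2
  · match n with
    | 0 => simp
    | n + 1 =>
      rw [lucasU_add_two]
      nlinarith [lucasU_nonneg ha hD n, show 0 ≤ B by omega]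
  · linarith [two_mul_lucasU_le_succ h2 hB hD n, lucasU_nonneg ha hD n]

theorem lucasU_lt_add_two (ha : 0 < a) (hB : B ≠ 0) (hD : 0 < a ^ 2 + 4 * B) (n : ℕ) :
    lucasU a B n < lucasU a B (n + 2) := by
  have hpos := lucasU_succ_pos ha hD n
  rcases (show 1 ≤ a by omega).eq_or_lt with rfl | h2
  · rw [lucasU_add_two]
    have hB : 1 ≤ B := by omega
    nlinarith [lucasU_nonneg ha hD n]
  · linarith [two_mul_lucasU_le_succ h2 hB hD (n + 1), two_mul_lucasU_le_succ h2 hB hD n,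
      lucasU_nonneg ha hD n]

end Growth

section Alternating

variable {v : ℕ → ℤ}

theorem abs_neg_one_pow_mul_of_nonneg {x : ℤ} (hx : 0 ≤ x) (n : ℕ) : |(-1) ^ n * x| = x := by
  rw [abs_mul, abs_pow, abs_neg, abs_one, one_pow, one_mul, abs_of_nonneg hx]

theorem alternating_ap_of_lt (h0 : ∀ n, 0 ≤ v n) (hmono : Monotone v)
    (hlt : ∀ n, v n < v (n + 2)) {k l m : ℕ} (hkm : k < m) (hkl : k ≠ l) (hlm : l ≠ m)
    (h : (-1) ^ (k + 1) * v k + (-1) ^ (m + 1) * v m = 2 * ((-1) ^ (l + 1) * v l)) :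
    ∃ n, v (n + 2) ≤ 2 * v n + v (n + 1) ∧ m = n + 2 ∧ l ≤ n := by
  have hk := abs_neg_one_pow_mul_of_nonneg (h0 k) (k + 1)
  have hl := abs_neg_one_pow_mul_of_nonneg (h0 l) (l + 1)
  have hm := abs_neg_one_pow_mul_of_nonneg (h0 m) (m + 1)
  rcases lt_or_gt_of_ne hlm with hlm | hml
  · obtain ⟨n, rfl⟩ : ∃ n, m = n + 2 := ⟨m - 2, by omega⟩
    have hkv : v k ≤ v (n + 1) := hmono (by omega)
    by_cases hln : l = n + 1
    · subst hln
      exfalso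
      have hkn : v k ≤ v n := hmono (by omega)
      have h₁ := hlt n
      have h₂ := hmono (show n ≤ n + 1 by omega)
      have h₃ : (-1 : ℤ) ^ (n + 2 + 1) = -(-1) ^ (n + 1 + 1) := by ring
      rw [h₃] at h
      have h₄ := h0 n
      obtain ⟨hk₁, hk₂⟩ := abs_le.mp hk.le
      rcases neg_one_pow_eq_or ℤ (n + 1 + 1) with he | he <;> rw [he] at h <;> linarith
    · refine ⟨n, ?_, rfl, by omega⟩
      have hlv : v l ≤ v n := hmono (by omega)
      have h₁ : (-1) ^ (n + 2 + 1) * v (n + 2) =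
          2 * ((-1) ^ (l + 1) * v l) - (-1) ^ (k + 1) * v k := by linarith
      have h₂ := abs_sub (2 * ((-1) ^ (l + 1) * v l)) ((-1) ^ (k + 1) * v k)
      rw [← h₁, abs_mul 2, hk, hl, hm, abs_two] at h₂
      linarith
  · exfalso
    have h₁ := abs_add_le ((-1) ^ (k + 1) * v k) ((-1) ^ (m + 1) * v m)
    rw [h, hk, hm, abs_mul 2, hl, abs_two] at h₁
    have h₂ := hlt k
    have h₃ : v (k + 2) ≤ v l := hmono (by omega)
    have h₄ : v m ≤ v l := hmono hml.le
    linarith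

theorem alternating_ap (h0 : ∀ n, 0 ≤ v n) (hmono : Monotone v)
    (hlt : ∀ n, v n < v (n + 2)) {k l m : ℕ} (hkm : k ≠ m) (hkl : k ≠ l) (hlm : l ≠ m)
    (h : (-1) ^ (k + 1) * v k + (-1) ^ (m + 1) * v m = 2 * ((-1) ^ (l + 1) * v l)) :
    ∃ n, v (n + 2) ≤ 2 * v n + v (n + 1) ∧ max k m = n + 2 ∧ l ≤ n := by
  rcases lt_or_gt_of_ne hkm with hkm | hmk
  · rw [max_eq_right hkm.le]
    exact alternating_ap_of_lt h0 hmono hlt hkm hkl hlm h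
  · rw [max_eq_left hmk.le]
    exact alternating_ap_of_lt h0 hmono hlt hmk hlm.symm hkl.symm (by rw [add_comm, h])

end Alternating

section Classification

variable {a B : ℤ} {k l m : ℕ}

theorem lucasAP_neg (ha : 0 < a) (hB : B ≠ 0) (hD : 0 < a ^ 2 + 4 * B)
    (h : (k, l, m) ∈ lucasAP (-a) B) :
    (k ≠ m ∧ k ≠ l ∧ l ≠ m) ∧ ∃ n, lucasU a B (n + 2) ≤ 2 * lucasU a B n + lucasU a B (n + 1) ∧
      max k m = n + 2 ∧ l ≤ n := by
  obtain ⟨h₁, h₂, h₃⟩ := h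
  have hkm : k ≠ m := fun e => by subst e; exact lt_asymm h₁ h₂
  have hkl : k ≠ l := fun e => by subst e; exact lt_irrefl _ h₁
  have hlm : l ≠ m := fun e => by subst e; exact lt_irrefl _ h₂
  simp only [lucasU_neg] at h₃
  exact ⟨⟨hkm, hkl, hlm⟩, alternating_ap (lucasU_nonneg ha hD) (lucasU_monotone ha hB hD)
    (lucasU_lt_add_two ha hB hD) hkm hkl hlm h₃⟩

theorem lucasAP_of_le_neg_two (ha : 2 ≤ a) (hB : B ≠ 0) (hD : 0 < a ^ 2 + 4 * B) :
    lucasAP (-a) B = ∅ := by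
  refine Set.eq_empty_of_forall_notMem fun ⟨k, l, m⟩ h => ?_
  obtain ⟨-, n, hn, -⟩ := lucasAP_neg (by omega) hB hD h
  have h₀ := two_mul_lucasU_le_succ ha hB hD n
  have h₁ := two_mul_lucasU_le_succ ha hB hD (n + 1)
  by_cases h1 : n = 1
  · linarith [two_mul_lucasU_lt_succ ha hB hD (show n + 1 ≠ 1 by omega)]
  · linarith [two_mul_lucasU_lt_succ ha hB hD h1]

theorem lucasAP_neg_one (hB : 3 ≤ B) (h : (k, l, m) ∈ lucasAP (-1) B) :
    (k, l, m) = (2, 0, 1) := by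
  have hD : (0 : ℤ) < 1 ^ 2 + 4 * B := by omega
  obtain ⟨⟨hkm, hkl, hlm⟩, n, hn, hmax, hln⟩ := lucasAP_neg one_pos (by omega) hD h
  rw [lucasU_add_two] at hn
  match n with
  | 0 =>
    obtain ⟨rfl, rfl, rfl⟩ | ⟨rfl, rfl, rfl⟩ : k = 2 ∧ l = 0 ∧ m = 1 ∨ k = 1 ∧ l = 0 ∧ m = 2 := by
      omega
    · rfl
    · have := h.1
      simp at this
  | n + 1 =>
    have := lucasU_succ_pos one_pos hD n
    nlinarith

theorem lucasAP_pos_index_lt (ha : 0 < a) (hB : B ≠ 0) (hD : 0 < a ^ 2 + 4 * B)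
    (h : (k, l, m) ∈ lucasAP a B) : k < l ∧ l < m :=
  ⟨(lucasU_monotone ha hB hD).reflect_lt h.1, (lucasU_monotone ha hB hD).reflect_lt h.2.1⟩

theorem lucasAP_of_two_le (ha : 2 ≤ a) (hB : B ≠ 0) (hD : 0 < a ^ 2 + 4 * B)
    (h : (k, l, m) ∈ lucasAP a B) : (k, l, m) = (0, 1, 2) := by
  obtain ⟨hkl, hlm⟩ := lucasAP_pos_index_lt (by omega) hB hD h
  obtain ⟨n, rfl⟩ : ∃ n, m = n + 1 := ⟨m - 1, by omega⟩
  have h₁ : lucasU a B l ≤ lucasU a B n := lucasU_monotone (by omega) hB hD (by omega)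
  have h₂ := lucasU_nonneg (by omega) hD k
  have h₃ : lucasU a B k + lucasU a B (n + 1) = 2 * lucasU a B l := h.2.2
  by_cases hn : n = 1
  · subst hn
    obtain ⟨rfl, rfl⟩ : k = 0 ∧ l = 1 := by omega
    rfl
  · linarith [two_mul_lucasU_lt_succ ha hB hD hn]

theorem lucasAP_one (hB : 3 ≤ B) (h : (k, l, m) ∈ lucasAP 1 B) :
    (k, l, m) = (1, 3, 4) ∨ (k, l, m) = (2, 3, 4) := by
  have hD : (0 : ℤ) < 1 ^ 2 + 4 * B := by omega
  have hmono := lucasU_monotone one_pos (by omega) hD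
  obtain ⟨hkl, hlm⟩ := lucasAP_pos_index_lt one_pos (by omega) hD h
  have h₂ := lucasU_nonneg one_pos hD k
  have h₃ : lucasU 1 B k + lucasU 1 B m = 2 * lucasU 1 B l := h.2.2
  obtain ⟨n, rfl⟩ : ∃ n, m = n + 2 := ⟨m - 2, by omega⟩
  by_cases hln : l = n + 1
  · subst hln
    match n with
    | 0 =>
      obtain rfl : k = 0 := by omega
      simp [lucasU_add_two] at h₃
    | 1 =>
      simp [lucasU_add_two] at h₃
      omega
    | 2 =>
      have hk : k ≠ 0 := by
        rintro rfl
        simp [lucasU_add_two] at h₃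
        omega
      obtain rfl | rfl : k = 1 ∨ k = 2 := by omega
      · exact Or.inl rfl
      · exact Or.inr rfl
    | n + 3 =>
      exfalso
      have hpos := lucasU_succ_pos one_pos hD n
      have hle := hmono (show n ≤ n + 1 by omega)
      have e₅ := lucasU_add_two 1 B (n + 3)
      have e₄ := lucasU_add_two 1 B (n + 2)
      have e₃ := lucasU_add_two 1 B (n + 1)
      have e₂ := lucasU_add_two 1 B n
      simp only [Nat.add_assoc, Nat.reduceAdd, one_mul] at h₃ e₅ e₄ e₃ e₂
      have key : lucasU 1 B n * B + lucasU 1 B (n + 1) =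
          B * (B - 1) * lucasU 1 B (n + 1) + lucasU 1 B k := by
        linear_combination -h₃ + e₅ - e₄ + (B - 1) * e₃ - e₂
      nlinarith [mul_le_mul_of_nonneg_left hle (show 0 ≤ B by omega),
        mul_pos hpos (show 0 < B * (B - 1) - B - 1 by nlinarith)]
  · exfalso
    have h₁ : lucasU 1 B l ≤ lucasU 1 B n := hmono (by omega)
    have h₄ := lucasU_add_two 1 B n
    have h₅ := lucasU_succ_pos one_pos hD n
    have h₆ := lucasU_nonneg one_pos hD n
    nlinarith

end Classification

section InfiniteFamilies

theorem infinite_lucasAP_one_one : (lucasAP 1 1).Infinite := by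
  refine Set.infinite_of_injective_forall_mem (f := fun n : ℕ => (n + 1, n + 3, n + 4))
    (fun i j h => by simpa using h) fun n => ?_
  have h₁ := lucasU_succ_pos (a := 1) (B := 1) (by norm_num) (by norm_num) n
  have h₂ := lucasU_succ_pos (a := 1) (B := 1) (by norm_num) (by norm_num) (n + 1)
  have e₃ := lucasU_add_two 1 1 (n + 1)
  have e₄ := lucasU_add_two 1 1 (n + 2)
  simp only [Nat.add_assoc, Nat.reduceAdd] at h₂ e₃ e₄
  refine ⟨?_, ?_, ?_⟩ <;> dsimp only <;> linarith

theorem infinite_lucasAP_neg_one_one : (lucasAP (-1) 1).Infinite := by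
  refine Set.infinite_of_injective_forall_mem
    (f := fun n : ℕ => (2 * n, 2 * n + 1, 2 * n + 3)) (fun i j h => by simpa using h) fun n => ?_
  have h : lucasU (-1) 1 (2 * n) ≤ 0 ∧ 0 < lucasU (-1) 1 (2 * n + 1) := by
    have h₁ := lucasU_nonneg (a := 1) (B := 1) (by norm_num) (by norm_num) (2 * n)
    have h₂ := lucasU_succ_pos (a := 1) (B := 1) (by norm_num) (by norm_num) (2 * n)
    simp only [lucasU_neg, pow_succ, pow_mul]
    constructor <;> norm_num <;> assumption
  obtain ⟨h₁, h₂⟩ := h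
  have e₂ := lucasU_add_two (-1) 1 (2 * n)
  have e₃ := lucasU_add_two (-1) 1 (2 * n + 1)
  simp only [Nat.add_assoc, Nat.reduceAdd] at e₃
  refine ⟨?_, ?_, ?_⟩ <;> dsimp only <;> linarith

theorem lucasU_one_two_even (n : ℕ) :
    lucasU 1 2 (2 * n + 2) = 2 * lucasU 1 2 (2 * n + 1) - 1 := by
  induction n with
  | zero => rfl
  | succ n ih =>
    have e₃ := lucasU_add_two 1 2 (2 * n + 1)
    have e₄ := lucasU_add_two 1 2 (2 * n + 2)
    simp only [Nat.mul_add, Nat.add_assoc, Nat.reduceAdd, Nat.reduceMul] at e₃ e₄ ⊢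
    linarith

theorem infinite_lucasAP_one_two : (lucasAP 1 2).Infinite := by
  refine Set.infinite_of_injective_forall_mem
    (f := fun n : ℕ => (1, 2 * n + 3, 2 * n + 4)) (fun i j h => by simpa using h) fun n => ?_
  have h₁ := lucasU_succ_pos (a := 1) (B := 2) (by norm_num) (by norm_num) (2 * n)
  have h₂ := lucasU_succ_pos (a := 1) (B := 2) (by norm_num) (by norm_num) (2 * n + 1)
  have e₃ := lucasU_add_two 1 2 (2 * n + 1)
  have e₄ := lucasU_one_two_even (n + 1)
  simp only [Nat.mul_add, Nat.add_assoc, Nat.reduceAdd, Nat.reduceMul] at h₂ e₃ e₄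
  refine ⟨?_, ?_, ?_⟩ <;> dsimp only [lucasU_one] <;> linarith

theorem lucasU_neg_one_two_even (n : ℕ) :
    lucasU (-1) 2 (2 * n + 2) = 1 - 2 * lucasU (-1) 2 (2 * n + 1) := by
  have h := lucasU_one_two_even n
  rw [lucasU_neg, lucasU_neg, h]
  simp only [pow_succ, pow_mul]
  norm_num

theorem infinite_lucasAP_neg_one_two : (lucasAP (-1) 2).Infinite := by
  refine Set.infinite_of_injective_forall_mem
    (f := fun n : ℕ => (2 * n + 2, 2 * n + 1, 2 * n + 3)) (fun i j h => by simpa using h)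
    fun n => ?_
  have h₁ : 0 < lucasU (-1) 2 (2 * n + 1) := by
    have h₂ := lucasU_succ_pos (a := 1) (B := 2) (by norm_num) (by norm_num) (2 * n)
    simp only [lucasU_neg, pow_succ, pow_mul]
    norm_num
    assumption
  have e₂ := lucasU_neg_one_two_even n
  have e₃ := lucasU_add_two (-1) 2 (2 * n + 1)
  simp only [Nat.add_assoc, Nat.reduceAdd] at e₃
  refine ⟨?_, ?_, ?_⟩ <;> dsimp only <;> linarith

end InfiniteFamilies

theorem stmt_10 (A B : ℤ) (hA : A ≠ 0) (hB : B ≠ 0) (hdom : A ^ 2 + 4 * B > 0)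
    (hnd : ∀ α β : ℂ, α + β = (A : ℂ) → α * β = -(B : ℂ) →
      ∀ n : ℕ, 0 < n → (α / β) ^ n ≠ 1)
    (hmore : ∃ p q r : ℕ × ℕ × ℕ, p ≠ q ∧ p ≠ r ∧ q ≠ r ∧
      p ∈ {p : ℕ × ℕ × ℕ | lucasU A B p.1 < lucasU A B p.2.1 ∧
        lucasU A B p.2.1 < lucasU A B p.2.2 ∧
        lucasU A B p.1 + lucasU A B p.2.2 = 2 * lucasU A B p.2.1} ∧
      q ∈ {p : ℕ × ℕ × ℕ | lucasU A B p.1 < lucasU A B p.2.1 ∧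
        lucasU A B p.2.1 < lucasU A B p.2.2 ∧
        lucasU A B p.1 + lucasU A B p.2.2 = 2 * lucasU A B p.2.1} ∧
      r ∈ {p : ℕ × ℕ × ℕ | lucasU A B p.1 < lucasU A B p.2.1 ∧
        lucasU A B p.2.1 < lucasU A B p.2.2 ∧
        lucasU A B p.1 + lucasU A B p.2.2 = 2 * lucasU A B p.2.1}) :
    {p : ℕ × ℕ × ℕ | lucasU A B p.1 < lucasU A B p.2.1 ∧
        lucasU A B p.2.1 < lucasU A B p.2.2 ∧
        lucasU A B p.1 + lucasU A B p.2.2 = 2 * lucasU A B p.2.1}.Infinite := by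
  obtain ⟨p, q, r, hpq, hpr, hqr, hp, hq, hr⟩ := hmore
  change p ∈ lucasAP A B at hp
  change q ∈ lucasAP A B at hq
  change r ∈ lucasAP A B at hr
  change (lucasAP A B).Infinite
  by_cases hA2 : 2 ≤ A
  · exact absurd ((lucasAP_of_two_le hA2 hB hdom hp).trans
      (lucasAP_of_two_le hA2 hB hdom hq).symm) hpq
  by_cases hA2' : A ≤ -2
  · have h := lucasAP_of_le_neg_two (a := -A) (by omega) hB (by rwa [neg_sq])
    rw [neg_neg] at h
    rw [h] at hp
    exact hp.elim
  obtain rfl | rfl : A = 1 ∨ A = -1 := by omega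
  · obtain rfl | rfl | hB3 : B = 1 ∨ B = 2 ∨ 3 ≤ B := by omega
    · exact infinite_lucasAP_one_one
    · exact infinite_lucasAP_one_two
    · rcases lucasAP_one hB3 hp with hp | hp <;> rcases lucasAP_one hB3 hq with hq | hq <;>
        rcases lucasAP_one hB3 hr with hr | hr <;> simp_all
  · obtain rfl | rfl | hB3 : B = 1 ∨ B = 2 ∨ 3 ≤ B := by omega
    · exact infinite_lucasAP_neg_one_one
    · exact infinite_lucasAP_neg_one_two
    · exact absurd ((lucasAP_neg_one hB3 hp).trans (lucasAP_neg_one hB3 hq).symm) hpq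
end

section
/- Let A and B be nonzero integers with A² + 4B < 0, and let α, β ∈ ℂ be the two roots of x² − A·x − B. If α/β is not a root of unity, then α and β are multiplicatively independent: for all integers t and s, α^t = β^s implies t = 0 and s = 0. -/
/-- Two complex numbers whose sum and product are the coefficients of a real quadratic with negative
discriminant are complex conjugates. -/
theorem Complex.eq_conj_of_add_of_mul {a b : ℝ} {α β : ℂ} (hdisc : a ^ 2 + 4 * b < 0)
    (hsum : α + β = (a : ℂ)) (hprod : α * β = -(b : ℂ)) : β = (starRingEnd ℂ) α := by
  have h1 := congrArg Complex.re hsum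
  have h2 := congrArg Complex.im hsum
  have h3 := congrArg Complex.re hprod
  have h4 := congrArg Complex.im hprod
  simp only [Complex.add_re, Complex.add_im, Complex.mul_re, Complex.mul_im, Complex.neg_re,
    Complex.neg_im, Complex.ofReal_re, Complex.ofReal_im, neg_zero] at h1 h2 h3 h4
  have him : β.im = -α.im := by linarith
  rw [him] at h3 h4
  have h5 : α.im * (β.re - α.re) = 0 := by linarith
  rcases mul_eq_zero.mp h5 with h | h
  · rw [h, zero_mul, sub_zero] at h3
    rw [← h1] at hdisc
    nlinarith [sq_nonneg (α.re - β.re)]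
  · exact Complex.ext (by simpa using sub_eq_zero.mp h) (by simpa using him)

theorem stmt_17 (A B : ℤ) (hA : A ≠ 0) (hB : B ≠ 0) (himag : A ^ 2 + 4 * B < 0)
    (α β : ℂ) (hsum : α + β = (A : ℂ)) (hprod : α * β = -(B : ℂ))
    (hnd : ∀ n : ℕ, 0 < n → (α / β) ^ n ≠ 1) :
    ∀ t s : ℤ, α ^ t = β ^ s → t = 0 ∧ s = 0 := by
  intro t s hts
  have hne : α * β ≠ 0 := by
    rw [hprod]
    exact neg_ne_zero.mpr (Int.cast_ne_zero.mpr hB)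
  have hα : α ≠ 0 := left_ne_zero_of_mul hne
  have hβ : β ≠ 0 := right_ne_zero_of_mul hne
  have hconj : β = (starRingEnd ℂ) α :=
    Complex.eq_conj_of_add_of_mul (a := A) (b := B) (by exact_mod_cast himag)
      (by simpa using hsum) (by simpa using hprod)
  have hnorm : ‖β‖ = ‖α‖ := by rw [hconj, Complex.norm_conj]
  have hsq : ‖α‖ * ‖α‖ = -(B : ℝ) := by
    have hBneg : (B : ℝ) ≤ 0 := by
      have : B ≤ 0 := by nlinarith [sq_nonneg A]
      exact_mod_cast this
    have h := congrArg norm hprod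
    rwa [norm_mul, hnorm, norm_neg, Complex.norm_intCast, abs_of_nonpos hBneg] at h
  have hα1 : ‖α‖ ≠ 1 := by
    intro h1
    have hB1 : B = -1 := by
      rw [h1] at hsq
      have : (B : ℝ) = -1 := by linarith
      exact_mod_cast this
    have hA1 : A ^ 2 = 1 := by
      have hpos : 0 < A ^ 2 := by positivity
      have hlt : A < 2 := by nlinarith
      have hgt : -2 < A := by nlinarith
      interval_cases A <;> simp_all
    have hA1' : (A : ℂ) ^ 2 = 1 := by exact_mod_cast hA1
    have hB1' : (B : ℂ) = -1 := by exact_mod_cast hB1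
    refine hnd 3 (by norm_num) ?_
    rw [div_pow, div_eq_one_iff_eq (pow_ne_zero 3 hβ)]
    rw [← hsum] at hA1'
    rw [hB1'] at hprod
    linear_combination (α - β) * hA1' - (α - β) * hprod
  have hst : t = s := by
    have h := congrArg norm hts
    rw [norm_zpow, norm_zpow, hnorm] at h
    exact zpow_right_injective₀ (norm_pos_iff.mpr hα) hα1 h
  subst hst
  suffices t = 0 from ⟨this, this⟩
  by_contra ht
  have hone : (α / β) ^ t = 1 := by
    rw [div_zpow, hts, div_self (zpow_ne_zero t hβ)]
  refine hnd t.natAbs (Int.natAbs_pos.mpr ht) ?_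
  rcases Int.natAbs_eq t with h | h
  · rw [h, zpow_natCast] at hone
    exact hone
  · rw [h, zpow_neg, zpow_natCast, inv_eq_one] at hone
    exact hone
end

section
/- Let A and B be nonzero integers with A² + 4B < 0 such that the ratio α/β of the two roots α, β ∈ ℂ of x² − A·x − B is not a root of unity. If the polynomial X² − A·X − B divides X^a + X^b − 2 in ℤ[X] for some integers a > b > 0, then A = −1 and B = −2. -/
open Polynomial

/-- Divisibility of `X ^ a + X ^ b - 2` by `X ^ 2 - A X - B` passes to values at the roots. -/
theorem pow_add_pow_eq_two_of_dvd {A B : ℤ} {a b : ℕ}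
    (hdvd : (X ^ 2 - C A * X - C B : ℤ[X]) ∣ (X ^ a + X ^ b - 2 : ℤ[X]))
    {z : ℂ} (hz : z ^ 2 - A * z - B = 0) : z ^ a + z ^ b = 2 := by
  obtain ⟨q, hq⟩ := hdvd
  have h := congrArg (aeval z) hq
  simp only [map_mul, map_add, map_sub, map_pow, aeval_X, map_ofNat, map_intCast, eq_intCast,
    hz, zero_mul] at h
  linear_combination h

/-- Divisibility of `X ^ a + X ^ b - 2` by `X ^ 2 - A X - B` passes to values at integers. -/
theorem eval_dvd_pow_add_pow_sub_two {A B : ℤ} {a b : ℕ}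
    (hdvd : (X ^ 2 - C A * X - C B : ℤ[X]) ∣ (X ^ a + X ^ b - 2 : ℤ[X])) (x : ℤ) :
    x ^ 2 - A * x - B ∣ x ^ a + x ^ b - 2 := by
  simpa using eval_dvd (x := x) hdvd

theorem stmt_18 (A B : ℤ) (hA : A ≠ 0) (hB : B ≠ 0) (himag : A ^ 2 + 4 * B < 0)
    (hnd : ∀ α β : ℂ, α + β = (A : ℂ) → α * β = -(B : ℂ) →
      ∀ n : ℕ, 0 < n → (α / β) ^ n ≠ 1)
    (a b : ℕ) (hb : 0 < b) (hab : b < a)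
    (hdvd : (X ^ 2 - C A * X - C B : ℤ[X]) ∣ (X ^ a + X ^ b - 2 : ℤ[X])) :
    A = -1 ∧ B = -2 := by
  obtain ⟨s, hs⟩ := IsAlgClosed.exists_eq_mul_self ((A : ℂ) ^ 2 + 4 * B)
  obtain ⟨α, hα⟩ : ∃ α : ℂ, α ^ 2 - A * α - B = 0 :=
    ⟨(A + s) / 2, by linear_combination -hs / 4⟩
  obtain ⟨β, hβ⟩ : ∃ β : ℂ, β = A - α := ⟨_, rfl⟩
  have hβ' : β ^ 2 - A * β - B = 0 := by subst hβ; linear_combination hα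
  have hmul : α * β = -(B : ℂ) := by subst hβ; linear_combination -hα
  have hBC : (B : ℂ) ≠ 0 := by exact_mod_cast hB
  have hα0 : α ≠ 0 := fun h => hBC (by linear_combination hmul - β * h)
  have hβ0 : β ≠ 0 := fun h => hBC (by linear_combination hmul - α * h)
  have hne : ∀ n : ℕ, 0 < n → α ^ n ≠ β ^ n := by
    intro n hn h
    refine hnd α β (by rw [hβ]; ring) hmul n hn ?_
    rw [div_pow, h, div_self (pow_ne_zero _ hβ0)]
  have hBdvd : B ∣ 2 := by
    simpa [hb.ne', (hb.trans hab).ne'] using eval_dvd_pow_add_pow_sub_two hdvd 0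
  have hBneg : B < 0 := by nlinarith
  have hBlow : -2 ≤ B := by
    have := Int.le_of_dvd (by norm_num) (neg_dvd.mpr hBdvd)
    omega
  have hAlow : -3 < A := by nlinarith
  have hAhigh : A < 3 := by nlinarith
  obtain rfl | rfl : B = -1 ∨ B = -2 := by omega
  · exfalso
    have hsq : (A : ℂ) ^ 2 = 1 := by
      obtain rfl | rfl : A = 1 ∨ A = -1 := by
        have : -2 < A := by nlinarith
        have : A < 2 := by nlinarith
        omega
      all_goals norm_num
    have cube : ∀ z : ℂ, z ^ 2 - A * z - (-1 : ℤ) = 0 → z ^ 3 = -A := by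
      intro z hz
      push_cast at hz
      linear_combination (z + A) * hz + z * hsq
    exact hne 3 (by norm_num) ((cube α hα).trans (cube β hβ').symm)
  · refine ⟨?_, rfl⟩
    by_contra hA1
    obtain hA2 | rfl : (A = 2 ∨ A = -2) ∨ A = 1 := by omega
    · have hsq : (A : ℂ) ^ 2 = 4 := by
        obtain rfl | rfl := hA2
        all_goals norm_num
      have fourth : ∀ z : ℂ, z ^ 2 - A * z - (-2 : ℤ) = 0 → z ^ 4 = -4 := by
        intro z hz
        push_cast at hz
        linear_combination (z ^ 2 + A * z + 2) * hz + z ^ 2 * hsq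
      exact hne 4 (by norm_num) ((fourth α hα).trans (fourth β hβ').symm)
    · have h4 : (4 : ℤ) ∣ 2 ^ a + 2 ^ b - 2 := by
        have := eval_dvd_pow_add_pow_sub_two hdvd 2
        norm_num at this
        exact this
      obtain ⟨k, rfl⟩ : ∃ k, a = k + 2 := ⟨a - 2, by omega⟩
      obtain rfl : b = 1 := by
        by_contra hb1
        obtain ⟨m, rfl⟩ : ∃ m, b = m + 2 := ⟨b - 2, by omega⟩
        rw [pow_add, pow_add] at h4
        omega
      have key : ∀ z : ℂ, z ≠ 0 → z ^ 2 - (1 : ℤ) * z - (-2 : ℤ) = 0 → z ^ k = -1 := by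
        intro z hz0 hz
        have h := pow_add_pow_eq_two_of_dvd hdvd hz
        push_cast at hz
        refine mul_right_cancel₀ (pow_ne_zero 2 hz0) ?_
        linear_combination h + hz
      have hk := key α hα0 hα
      rcases Nat.eq_zero_or_pos k with rfl | hkpos
      · norm_num at hk
      · exact hne k hkpos (hk.trans (key β hβ0 hβ').symm)
end
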